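/- arXiv:2006.07413 — 2 statements merged into one kernel-verified Lean document; each statement's English description precedes it below -/
import Mathlib

section
/- Let V_1, V_2, V_3, V_4 ∈ ℝ³ (indices taken modulo 4) satisfy det(V_{i-1}, V_i, V_{i+1}) ≠ 0 for all i, and let G be Glick's operator of this 4-tuple. Then for every vector V ∈ ℝ³, the vector G(V) − 2·V lies in the intersection of the linear spans span{V_1, V_3} and span{V_2, V_4}. (For quadrilaterals, G − 2I is a constant projective map onto the intersection of the diagonals.) -/
/-- `det3 A B C` is the determinant of the 3×3 real matrix with columns `A`, `B`, `C`. -/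
noncomputable def det3 (A B C : Fin 3 → ℝ) : ℝ := (Matrix.of ![A, B, C]).transpose.det

/-- Glick's operator of a family of lifts `V : ZMod n → ℝ³`:
`G(W) = n • W − ∑ i, (det(V_{i-1}, W, V_{i+1}) / det(V_{i-1}, V_i, V_{i+1})) • V_i`. -/
noncomputable def glick (n : ℕ) (V : ZMod n → Fin 3 → ℝ) (W : Fin 3 → ℝ) : Fin 3 → ℝ :=
  (n : ℝ) • W - ∑ i ∈ Finset.range n,
    (det3 (V ((i : ZMod n) - 1)) W (V ((i : ZMod n) + 1)) /
      det3 (V ((i : ZMod n) - 1)) (V (i : ZMod n)) (V ((i : ZMod n) + 1))) • V (i : ZMod n)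

theorem det3_expand (A B C : Fin 3 → ℝ) :
    det3 A B C = A 0 * (B 1 * C 2 - B 2 * C 1) - B 0 * (A 1 * C 2 - A 2 * C 1)
      + C 0 * (A 1 * B 2 - A 2 * B 1) := by
  simp [det3, Matrix.det_fin_three]
  ring

/-- Cramer's rule in dimension three. -/
theorem det3_smul_eq (A B C X : Fin 3 → ℝ) :
    det3 A B C • X = det3 X B C • A + det3 A X C • B + det3 A B X • C := by
  ext k
  fin_cases k <;> simp [det3_expand] <;> ring

theorem mem_span_pair_of_det3_eq_zero {A B C X : Fin 3 → ℝ} (h : det3 A B C ≠ 0)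
    (hX : det3 A X C = 0) : X ∈ Submodule.span ℝ {A, C} := by
  rw [← Submodule.smul_mem_iff _ h, det3_smul_eq, hX, zero_smul, add_zero,
    Submodule.mem_span_pair]
  exact ⟨_, _, rfl⟩

/-- The part of `2 • W` left after removing its components off the plane of `P` and `R`,
measured once along `Q` and once along `S`, lies in that plane. -/
theorem two_smul_sub_mem_span_pair {P Q R S : Fin 3 → ℝ} (hQ : det3 P Q R ≠ 0)
    (hS : det3 R S P ≠ 0) (W : Fin 3 → ℝ) (p r : ℝ) :
    (2 : ℝ) • W - (p • P + r • R + (det3 P W R / det3 P Q R) • Q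
      + (det3 R W P / det3 R S P) • S) ∈ Submodule.span ℝ {P, R} := by
  refine mem_span_pair_of_det3_eq_zero hQ ?_
  have linear (q s : ℝ) : det3 P ((2 : ℝ) • W - (p • P + r • R + q • Q + s • S)) R =
      det3 P W R - q * det3 P Q R - (det3 R W P - s * det3 R S P) := by
    simp only [det3_expand, Pi.sub_apply, Pi.add_apply, Pi.smul_apply, smul_eq_mul]
    ring
  rw [linear, div_mul_cancel₀ _ hQ, div_mul_cancel₀ _ hS]
  ring

/-- For a quadrilateral, `G − 2I` maps everything into the intersection of the diagonals. -/
theorem quadrilateral_glick_constant (V : ZMod 4 → Fin 3 → ℝ)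
    (hV : ∀ i : ZMod 4, det3 (V (i - 1)) (V i) (V (i + 1)) ≠ 0) :
    ∀ W : Fin 3 → ℝ, glick 4 V W - (2 : ℝ) • W ∈
      Submodule.span ℝ {V 1, V 3} ⊓ Submodule.span ℝ {V 2, V 4} := by
  intro W
  have h0 : det3 (V 3) (V 0) (V 1) ≠ 0 := hV 0
  have h1 : det3 (V 0) (V 1) (V 2) ≠ 0 := hV 1
  have h2 : det3 (V 1) (V 2) (V 3) ≠ 0 := hV 2
  have h3 : det3 (V 2) (V 3) (V 0) ≠ 0 := hV 3
  have hG : glick 4 V W - (2 : ℝ) • W = (2 : ℝ) • W -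
      ((det3 (V 3) W (V 1) / det3 (V 3) (V 0) (V 1)) • V 0
        + (det3 (V 0) W (V 2) / det3 (V 0) (V 1) (V 2)) • V 1
        + (det3 (V 1) W (V 3) / det3 (V 1) (V 2) (V 3)) • V 2
        + (det3 (V 2) W (V 0) / det3 (V 2) (V 3) (V 0)) • V 3) := by
    simp only [glick, Finset.sum_range_succ, Finset.sum_range_zero, zero_add]
    rw [sub_right_comm, ← sub_smul]
    norm_num
    rfl
  rw [hG, show V 4 = V 0 from rfl]
  refine Submodule.mem_inf.2 ⟨?_, ?_⟩
  · have h := two_smul_sub_mem_span_pair h2 h0 W (det3 (V 0) W (V 2) / det3 (V 0) (V 1) (V 2))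
      (det3 (V 2) W (V 0) / det3 (V 2) (V 3) (V 0))
    convert h using 2
    abel
  · rw [Set.pair_comm]
    have h := two_smul_sub_mem_span_pair h1 h3 W (det3 (V 3) W (V 1) / det3 (V 3) (V 0) (V 1))
      (det3 (V 1) W (V 3) / det3 (V 1) (V 2) (V 3))
    convert h using 2
    abel
end

section
/- Let n ≥ 3, let a, b, c : ℤ → ℝ be n-periodic sequences, and let V : ℤ → ℝ³ be an n-periodic sequence of vectors satisfying V_{i+3} = a_i·V_{i+2} + b_i·V_{i+1} + c_i·V_i and det(V_i, V_{i+1}, V_{i+2}) ≠ 0 for all i (so in particular c_i ≠ 0). For z ≠ 0 let U_i(z) be the 3×3 matrix with rows (a_i, 1, 0), (b_i/z, 0, 1), (c_i/z, 0, 0); let W₀ be the 3×3 matrix with columns V_2, V_1, V_0, and define M(z) = W₀·U_0(z)·U_1(z)⋯U_{n-1}(z)·W₀⁻¹. Then M(1) = I, the function z ↦ M(z) is differentiable at z = 1, and for every V ∈ ℝ³ the derivative satisfies M'(1)·V = −∑_{i=0}^{n-1} (det(V_{i-1}, V, V_{i+1})/det(V_{i-1}, V_i, V_{i+1}))·V_i.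 Equivalently, M'(1) = G − n·I, where G is Glick's operator of the closed polygon with lifts V_0, …, V_{n-1}; that is, the infinitesimal monodromy of the closed polygon coincides with Glick's operator up to addition of a scalar matrix. -/
open Matrix

theorem det3_eq (A B C : Fin 3 → ℝ) :
    det3 A B C = A 0 * B 1 * C 2 - A 0 * B 2 * C 1 - A 1 * B 0 * C 2 + A 1 * B 2 * C 0
      + A 2 * B 0 * C 1 - A 2 * B 1 * C 0 := by
  simp only [det3, det_fin_three, transpose_apply, of_apply, cons_val]
  ring

/-- Entrywise product rule for matrix-valued functions of a real variable. -/
theorem hasDerivAt_matrix_mul {A B : ℝ → Matrix (Fin 3) (Fin 3) ℝ}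
    {A' B' : Matrix (Fin 3) (Fin 3) ℝ} {x : ℝ}
    (hA : ∀ j k, HasDerivAt (fun z => A z j k) (A' j k) x)
    (hB : ∀ j k, HasDerivAt (fun z => B z j k) (B' j k) x) (j k : Fin 3) :
    HasDerivAt (fun z => (A z * B z) j k) ((A' * B x + A x * B') j k) x := by
  simp only [Matrix.add_apply, mul_apply, ← Finset.sum_add_distrib]
  exact HasDerivAt.fun_sum fun l _ => (hA j l).mul (hB l k)

/-- The frame matrix with columns `V (i + 2)`, `V (i + 1)`, `V i`. -/
def frame (V : ℤ → Fin 3 → ℝ) (i : ℤ) : Matrix (Fin 3) (Fin 3) ℝ :=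
  (of ![V (i + 2), V (i + 1), V i])ᵀ

theorem det_frame (V : ℤ → Fin 3 → ℝ) (i : ℤ) :
    (frame V i).det = -det3 (V i) (V (i + 1)) (V (i + 2)) := by
  change det3 (V (i + 2)) (V (i + 1)) (V i) = _
  simp only [det3_eq]
  ring

/-- The first coordinate of `W` in the basis `V (i + 3)`, `V (i + 2)`, `V (i + 1)`. -/
noncomputable def leadCoord (V : ℤ → Fin 3 → ℝ) (i : ℤ) (W : Fin 3 → ℝ) : ℝ :=
  det3 W (V (i + 2)) (V (i + 1)) / det3 (V (i + 3)) (V (i + 2)) (V (i + 1))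

/-- The linear map `W ↦ leadCoord V i W • X`, as a matrix. -/
noncomputable def leadMatrix (V : ℤ → Fin 3 → ℝ) (i : ℤ) (X : Fin 3 → ℝ) :
    Matrix (Fin 3) (Fin 3) ℝ :=
  of fun j k => leadCoord V i (Pi.single k 1) * X j

theorem leadMatrix_mulVec (V : ℤ → Fin 3 → ℝ) (i : ℤ) (X W : Fin 3 → ℝ) :
    leadMatrix V i X *ᵥ W = leadCoord V i W • X := by
  ext j
  simp [leadMatrix, leadCoord, mulVec, dotProduct, Fin.sum_univ_three, det3_eq, Pi.single_apply]
  ring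

theorem leadMatrix_mul_frame (V : ℤ → Fin 3 → ℝ) (i : ℤ) (X : Fin 3 → ℝ)
    (h : det3 (V (i + 3)) (V (i + 2)) (V (i + 1)) ≠ 0) :
    leadMatrix V i X * frame V (i + 1) = (of ![X, 0, 0])ᵀ := by
  have hcol (k : Fin 3) : (leadMatrix V i X * frame V (i + 1)).col k =
      leadCoord V i ((frame V (i + 1)).col k) • X := by
    rw [← leadMatrix_mulVec]
    rfl
  have h3 : i + 1 + 2 = i + 3 := by ring
  have h2 : i + 1 + 1 = i + 2 := by ring
  have c0 : (frame V (i + 1)).col 0 = V (i + 3) := by rw [← h3]; rfl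
  have c1 : (frame V (i + 1)).col 1 = V (i + 2) := by rw [← h2]; rfl
  have c2 : (frame V (i + 1)).col 2 = V (i + 1) := rfl
  have l0 : leadCoord V i (V (i + 3)) = 1 := div_self h
  have l1 : leadCoord V i (V (i + 2)) = 0 := by
    rw [leadCoord, det3_eq (V (i + 2)), div_eq_zero_iff]; left; ring
  have l2 : leadCoord V i (V (i + 1)) = 0 := by
    rw [leadCoord, det3_eq (V (i + 1)), div_eq_zero_iff]; left; ring
  ext j k
  have := congrFun (hcol k) j
  fin_cases k
  · simpa [c0, l0] using this
  · simpa [c1, l1] using this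
  · simpa [c2, l2] using this

theorem sum_range_shift {n : ℕ} {f : ℤ → Fin 3 → ℝ} (hf : ∀ i, f (i + n) = f i) (k : ℕ) :
    ∑ i ∈ Finset.range n, f ((i : ℤ) + k) = ∑ i ∈ Finset.range n, f i := by
  induction k with
  | zero => simp
  | succ k ih =>
    rw [← ih, ← sub_eq_zero, ← Finset.sum_sub_distrib]
    have := Finset.sum_range_sub (fun i : ℕ => f ((i : ℤ) + k)) n
    simp only [Nat.cast_add, Nat.cast_one] at this ⊢
    rw [show (n : ℤ) + k = k + n by ring, hf] at this
    simpa [add_assoc, add_comm, add_left_comm] using this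

/-- Main theorem: the infinitesimal monodromy of a closed polygon coincides with Glick's
operator up to addition of a scalar matrix. Here `M(z) = W₀·U₀(z)⋯U_{n-1}(z)·W₀⁻¹` is the
monodromy of the scaling deformation; `M(1) = I`, `M` is differentiable at `z = 1`, and
`M'(1)·V = −∑ᵢ (det(V_{i-1}, V, V_{i+1})/det(V_{i-1}, V_i, V_{i+1}))·V_i = (G − n·I)(V)`. -/
theorem infinitesimal_monodromy_eq_glick (n : ℕ) (hn : 3 ≤ n) (a b c : ℤ → ℝ)
    (ha : ∀ i : ℤ, a (i + n) = a i) (hb : ∀ i : ℤ, b (i + n) = b i)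
    (hc : ∀ i : ℤ, c (i + n) = c i)
    (V : ℤ → Fin 3 → ℝ) (hVper : ∀ i : ℤ, V (i + n) = V i)
    (hrec : ∀ i : ℤ, V (i + 3) = a i • V (i + 2) + b i • V (i + 1) + c i • V i)
    (hdet : ∀ i : ℤ, det3 (V i) (V (i + 1)) (V (i + 2)) ≠ 0)
    (U : ℤ → ℝ → Matrix (Fin 3) (Fin 3) ℝ)
    (hU : ∀ i : ℤ, ∀ z : ℝ, U i z = !![a i, 1, 0; b i / z, 0, 1; c i / z, 0, 0])
    (W₀ : Matrix (Fin 3) (Fin 3) ℝ) (hW₀ : W₀ = (Matrix.of ![V 2, V 1, V 0]).transpose)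
    (M : ℝ → Matrix (Fin 3) (Fin 3) ℝ)
    (hM : ∀ z : ℝ, M z = W₀ * ((List.range n).map fun i => U (i : ℤ) z).prod * W₀⁻¹) :
    M 1 = 1 ∧
    ∃ M' : Matrix (Fin 3) (Fin 3) ℝ,
      (∀ j k, HasDerivAt (fun z => M z j k) (M' j k) 1) ∧
      ∀ W : Fin 3 → ℝ,
        M'.mulVec W =
          -∑ i ∈ Finset.range n,
            (det3 (V ((i : ℤ) - 1)) W (V ((i : ℤ) + 1)) /
              det3 (V ((i : ℤ) - 1)) (V (i : ℤ)) (V ((i : ℤ) + 1))) • V (i : ℤ) := by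
  have hdet' (i : ℤ) : det3 (V (i + 2)) (V (i + 1)) (V i) ≠ 0 := by
    change (frame V i).det ≠ 0
    rw [det_frame]
    exact neg_ne_zero.mpr (hdet i)
  have hdet3 (i : ℤ) : det3 (V (i + 3)) (V (i + 2)) (V (i + 1)) ≠ 0 := by
    have := hdet' (i + 1)
    rwa [show i + 1 + 2 = i + 3 by ring, show i + 1 + 1 = i + 2 by ring] at this
  have hW : W₀ = frame V 0 := by simp [hW₀, frame]
  have hstep (i : ℤ) : frame V i * U i 1 = frame V (i + 1) := by
    have h3 : V (i + 1 + 2) = V (i + 3) := by congr 1; ring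
    have h2 : V (i + 1 + 1) = V (i + 2) := by congr 1; ring
    ext j k
    rw [hU, frame, frame, h3, h2, hrec]
    fin_cases k <;> simp [mul_apply, Fin.sum_univ_three]
    ring
  have hunit : IsUnit (frame V 0).det := by
    rw [det_frame]
    exact (neg_ne_zero.mpr (hdet 0)).isUnit
  have hframe_n : frame V n = frame V 0 := by
    have h (k : ℤ) : V (n + k) = V k := by rw [add_comm, hVper]
    have h0 := hVper 0
    rw [zero_add] at h0
    simp [frame, h, h0]
  let P (k : ℕ) (z : ℝ) := W₀ * ((List.range k).map fun i => U (i : ℤ) z).prod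
  have hPsucc (k : ℕ) (z : ℝ) : P (k + 1) z = P k z * U k z := by
    simp [P, List.range_succ, Matrix.mul_assoc]
  have hP1 (k : ℕ) : P k 1 = frame V k := by
    induction k with
    | zero => simp [P, hW]
    | succ k ih => rw [hPsucc, ih, hstep]; simp
  let X (i : ℤ) : Fin 3 → ℝ := -(b i • V (i + 1) + c i • V i)
  let S (k : ℕ) := ∑ i ∈ Finset.range k, leadMatrix V i (X i)
  let D (i : ℤ) : Matrix (Fin 3) (Fin 3) ℝ := !![0, 0, 0; -b i, 0, 0; -c i, 0, 0]
  have hUderiv (i : ℤ) (j k : Fin 3) : HasDerivAt (fun z => U i z j k) (D i j k) 1 := by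
    have hdiv (r : ℝ) : HasDerivAt (fun z : ℝ => r / z) (-r) 1 := by
      simpa [div_eq_mul_inv] using (hasDerivAt_inv (one_ne_zero (α := ℝ))).const_mul r
    simp only [hU]
    fin_cases j <;> fin_cases k <;>
      first
        | exact hdiv _
        | exact hasDerivAt_const _ _
  have hPderiv (k : ℕ) : ∀ i j, HasDerivAt (fun z => P k z i j) ((S k * frame V k) i j) 1 := by
    induction k with
    | zero =>
      intro i j
      simpa [P, S] using hasDerivAt_const (1 : ℝ) (W₀ i j)
    | succ k ih =>
      intro i j
      have hXD : leadMatrix V k (X k) * frame V (k + 1) = frame V k * D k := by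
        rw [leadMatrix_mul_frame V k _ (hdet3 k)]
        ext j l
        fin_cases l <;> simp [D, X, frame, mul_apply, Fin.sum_univ_three]
        ring
      have := hasDerivAt_matrix_mul ih (hUderiv k) i j
      simp only [← hPsucc, hP1, Matrix.mul_assoc, hstep] at this
      rw [← hXD, ← Matrix.add_mul] at this
      simpa [S, Finset.sum_range_succ] using this
  refine ⟨?_, S n, fun j k => ?_, fun W => ?_⟩
  · rw [hM]
    change P n 1 * W₀⁻¹ = 1
    rw [hP1, hframe_n, hW, mul_nonsing_inv _ hunit]
  · have := hasDerivAt_matrix_mul (hPderiv n) (fun j k => hasDerivAt_const (1 : ℝ) (W₀⁻¹ j k)) j k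
    rw [show (fun j k => (0 : ℝ)) = (0 : Matrix (Fin 3) (Fin 3) ℝ) from rfl] at this
    rw [Matrix.mul_zero, add_zero, Matrix.mul_assoc, hframe_n, hW,
      mul_nonsing_inv _ hunit, Matrix.mul_one] at this
    have hMP : M = fun z => P n z * W₀⁻¹ := funext hM
    rwa [hMP, hW]
  · let g (i : ℤ) : Fin 3 → ℝ :=
      (det3 (V (i - 1)) W (V (i + 1)) / det3 (V (i - 1)) (V i) (V (i + 1))) • V i
    let F (i : ℤ) : Fin 3 → ℝ := leadCoord V i W • V (i + 3)
    have hper (i k : ℤ) : V (i + n + k) = V (i + k) := by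
      rw [add_right_comm, hVper]
    have hg (i : ℤ) : g (i + n) = g i := by
      simp only [g, sub_eq_add_neg, hper, hVper]
    have hF (i : ℤ) : F (i + n) = F i := by
      simp only [F, leadCoord, hper]
    have key (i : ℤ) : leadCoord V (i + 1) W • X (i + 1) = F i - F (i + 1) - g (i + 3) := by
      have hr : V (i + 4) = a (i + 1) • V (i + 3) + b (i + 1) • V (i + 2) + c (i + 1) • V (i + 1) := by
        have := hrec (i + 1)
        simpa only [add_assoc, Int.reduceAdd] using this
      have hd0 := hdet3 i
      have hd1 := hdet3 (i + 1)
      simp only [add_assoc, Int.reduceAdd] at hd1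
      have hX : X (i + 1) = a (i + 1) • V (i + 3) - V (i + 4) := by
        simp only [X, hr, add_assoc, Int.reduceAdd]
        abel
      have hcoef : det3 (V (i + 2)) W (V (i + 4)) / det3 (V (i + 2)) (V (i + 3)) (V (i + 4)) =
          leadCoord V i W - a (i + 1) * leadCoord V (i + 1) W := by
        have e1 : det3 (V (i + 4)) (V (i + 3)) (V (i + 2)) =
            c (i + 1) * det3 (V (i + 3)) (V (i + 2)) (V (i + 1)) := by
          simp only [det3_eq, hr, Pi.add_apply, Pi.smul_apply, smul_eq_mul]
          ring
        have e2 : det3 (V (i + 2)) (V (i + 3)) (V (i + 4)) =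
            -(c (i + 1) * det3 (V (i + 3)) (V (i + 2)) (V (i + 1))) := by
          rw [← e1]
          simp only [det3_eq]
          ring
        have e3 : det3 (V (i + 2)) W (V (i + 4)) =
            a (i + 1) * det3 W (V (i + 3)) (V (i + 2)) -
              c (i + 1) * det3 W (V (i + 2)) (V (i + 1)) := by
          simp only [det3_eq, hr, Pi.add_apply, Pi.smul_apply, smul_eq_mul]
          ring
        rw [e1] at hd1
        have hc0 := left_ne_zero_of_mul hd1
        simp only [leadCoord, add_assoc, Int.reduceAdd]
        rw [e1, e2, e3]
        field_simp
        ring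
      have hg3 : g (i + 3) =
          (leadCoord V i W - a (i + 1) * leadCoord V (i + 1) W) • V (i + 3) := by
        rw [← hcoef]
        simp only [g, add_assoc, add_sub_assoc, Int.reduceAdd, Int.reduceSub]
      rw [hX, hg3]
      simp only [F, add_assoc, Int.reduceAdd]
      module
    have hT (i : ℤ) : leadCoord V (i + n) W • X (i + n) = leadCoord V i W • X i := by
      simp only [X, leadCoord, hper, hb, hc, hVper]
    calc S n *ᵥ W = ∑ i ∈ Finset.range n, leadCoord V i W • X i := by
          simp only [S, sum_mulVec, leadMatrix_mulVec]
      _ = ∑ i ∈ Finset.range n, (F i - F ((i : ℤ) + 1) - g ((i : ℤ) + 3)) := by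
          refine (sum_range_shift (f := fun i => leadCoord V i W • X i) hT 1).symm.trans ?_
          exact Finset.sum_congr rfl fun i _ => key i
      _ = -∑ i ∈ Finset.range n, g i := by
          have h1 := sum_range_shift hF 1
          have h3 := sum_range_shift hg 3
          push_cast at h1 h3
          rw [Finset.sum_sub_distrib, Finset.sum_sub_distrib, h1, h3, sub_self, zero_sub]
end
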